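/- Let N ≥ 1 be an integer, l ∈ ℤ, and τ ∈ ℂ with Im τ > 0. Define ψ^{(l)}(x,y) := exp(iπNτy²)·θ_{l/N}(N(x+τy), Nτ). Then the squared L² norm over the fundamental domain is ∫₀¹∫₀¹ |ψ^{(l)}(x,y)|² dx dy = (2N·Im τ)^{−1/2}. In particular the norm depends only on Im τ and not on l. -/

import Mathlib

open scoped BigOperators

/-- Theta function with characteristic `a`:
`θ_a(w,σ) = Σ_{n∈ℤ} exp(iπσ(n+a)² + 2πi(n+a)w)`. -/
noncomputable def jtheta (a : ℝ) (w σ : ℂ) : ℂ :=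
  ∑' n : ℤ, Complex.exp (Real.pi * Complex.I * σ * ((n : ℂ) + (a : ℂ)) ^ 2 +
    2 * Real.pi * Complex.I * ((n : ℂ) + (a : ℂ)) * w)

open MeasureTheory intervalIntegral in
/-- Parseval's identity for an absolutely convergent trigonometric series with distinct integer
frequencies. -/
lemma integral_norm_sq_tsum_exp {ι : Type*} [Countable ι] (c : ι → ℂ) (hc : Summable (‖c ·‖))
    (k : ι → ℤ) (hk : Function.Injective k) :
    ∫ x in (0 : ℝ)..1, ‖∑' n, c n * Complex.exp (2 * Real.pi * Complex.I * k n * x)‖ ^ 2 =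
      ∑' n, ‖c n‖ ^ 2 := by
  classical
  set e : ι → ℝ → ℂ := fun n x ↦ Complex.exp (2 * Real.pi * Complex.I * k n * x) with he
  have hnorm (n : ι) (x : ℝ) : ‖e n x‖ = 1 := by
    have : 2 * Real.pi * Complex.I * k n * x = ((2 * Real.pi * k n * x : ℝ) : ℂ) * Complex.I := by
      push_cast; ring
    simp only [he, this, Complex.norm_exp_ofReal_mul_I]
  have hcont (n : ι) : Continuous (e n) := by simp only [he]; fun_prop
  have hsum (x : ℝ) : Summable fun n ↦ ‖c n * e n x‖ := by simpa [hnorm] using hc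
  let F : ι × ι → ℝ → ℂ := fun p x ↦ (c p.1 * e p.1 x) * (starRingEnd ℂ) (c p.2 * e p.2 x)
  have hF (p : ι × ι) (x : ℝ) : ‖F p x‖ = ‖c p.1‖ * ‖c p.2‖ := by simp [F, hnorm]
  have hsum' (x : ℝ) : Summable fun n ↦ ‖(starRingEnd ℂ) (c n * e n x)‖ := by
    simpa only [RCLike.norm_conj] using hsum x
  have hHas (x : ℝ) :
      HasSum (fun p ↦ F p x) (((‖∑' n, c n * e n x‖ ^ 2 : ℝ)) : ℂ) := by
    have h := (summable_mul_of_summable_norm (hsum x) (hsum' x)).hasSum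
    rw [← tsum_mul_tsum_of_summable_norm (hsum x) (hsum' x), ← Complex.conj_tsum,
      Complex.mul_conj'] at h
    exact_mod_cast h
  have hb : Summable fun p : ι × ι ↦ ‖c p.1‖ * ‖c p.2‖ :=
    hc.mul_of_nonneg hc (fun _ ↦ norm_nonneg _) (fun _ ↦ norm_nonneg _)
  have hint := hasSum_integral_of_dominated_convergence (μ := volume) (a := (0 : ℝ)) (b := 1)
    (F := F) (f := fun x ↦ ((‖∑' n, c n * e n x‖ ^ 2 : ℝ) : ℂ))
    (fun p _ ↦ ‖c p.1‖ * ‖c p.2‖)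
    (fun p ↦ by
      refine Continuous.aestronglyMeasurable ?_
      have := hcont p.1
      have := hcont p.2
      fun_prop)
    (fun p ↦ .of_forall fun x _ ↦ (hF p x).le)
    (.of_forall fun _ _ ↦ hb) (by simp) (.of_forall fun x _ ↦ hHas x)
  have horth (p : ι × ι) :
      ∫ x in (0 : ℝ)..1, F p x = if p.1 = p.2 then ((‖c p.1‖ ^ 2 : ℝ) : ℂ) else 0 := by
    have hFp (x : ℝ) : F p x = (c p.1 * (starRingEnd ℂ) (c p.2)) *
        Complex.exp ((2 * Real.pi * Complex.I * ((k p.1 - k p.2 : ℤ) : ℂ)) * x) := by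
      have : (starRingEnd ℂ) (e p.2 x) =
          Complex.exp (-(2 * Real.pi * Complex.I * k p.2 * x)) := by
        simp [he, ← Complex.exp_conj, Complex.conj_ofNat]
      simp only [F, map_mul, this]
      simp only [he]
      rw [mul_mul_mul_comm, ← Complex.exp_add]
      push_cast
      ring_nf
    simp only [hFp, intervalIntegral.integral_const_mul]
    split_ifs with h
    · simp [h, Complex.mul_conj']
    · have hne : 2 * Real.pi * Complex.I * ((k p.1 - k p.2 : ℤ) : ℂ) ≠ 0 :=
        mul_ne_zero Complex.two_pi_I_ne_zero
          (Int.cast_ne_zero.mpr (sub_ne_zero.mpr (hk.ne h)))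
      rw [integral_exp_mul_complex hne]
      have h1 : Complex.exp (2 * Real.pi * Complex.I * ((k p.1 - k p.2 : ℤ) : ℂ)) = 1 := by
        rw [mul_comm]; exact Complex.exp_int_mul_two_pi_mul_I _
      simp [-Int.cast_sub, h1]
  simp only [horth] at hint
  have hdiag : HasSum (fun n ↦ ((‖c n‖ ^ 2 : ℝ) : ℂ))
      (∫ x in (0 : ℝ)..1, ((‖∑' n, c n * e n x‖ ^ 2 : ℝ) : ℂ)) := by
    have hinj : Function.Injective fun n : ι ↦ (n, n) := fun a b h ↦ congrArg Prod.fst h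
    rw [← hinj.hasSum_iff] at hint
    · simpa [Function.comp_def] using hint
    · rintro ⟨a, b⟩ hab
      have : a ≠ b := by rintro rfl; exact hab ⟨a, rfl⟩
      simp [this]
  rw [intervalIntegral.integral_ofReal] at hdiag
  exact (Complex.hasSum_ofReal.mp hdiag).tsum_eq.symm

open MeasureTheory in
/-- Unfolding: integrating the periodization of an integrable function over a period gives the
integral over the line. -/
lemma integral_tsum_comp_add_int {g : ℝ → ℝ} (hg : Integrable g) :
    ∫ y in (0 : ℝ)..1, ∑' n : ℤ, g (y + n) = ∫ y, g y := by
  have h := hg.hasSum_intervalIntegral_comp_add_int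
  have h' := hg.norm.hasSum_intervalIntegral_comp_add_int
  simp only [intervalIntegral.integral_of_le zero_le_one] at h h' ⊢
  rw [← integral_tsum_of_summable_integral_norm
    (fun n : ℤ ↦ (hg.comp_add_right (n : ℝ)).integrableOn) h'.summable]
  exact h.tsum_eq

/-- Absolute convergence of the Gaussian series `∑ exp(iπσ(n+b)²)` for `Im σ > 0`. -/
lemma summable_norm_exp_shifted_gaussian {σ : ℂ} (hσ : 0 < σ.im) (b : ℂ) :
    Summable fun n : ℤ ↦ ‖Complex.exp (Real.pi * Complex.I * σ * (n + b) ^ 2)‖ := by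
  refine Summable.norm ?_
  refine (((summable_jacobiTheta₂_term_iff (σ * b) σ).mpr hσ).mul_left
    (Complex.exp (Real.pi * Complex.I * σ * b ^ 2))).congr fun n ↦ ?_
  rw [jacobiTheta₂_term, ← Complex.exp_add]
  ring_nf

/-- The squared L² norm of the lowest-Landau-level wavefunction `ψ^{(l)}` over the
fundamental domain equals `(2N·Im τ)^{-1/2}`; in particular it is independent of `l`. -/
theorem stmt_2 (N : ℕ) (hN : 1 ≤ N) (l : ℤ) (τ : ℂ) (hτ : 0 < τ.im)
    (ψ : ℝ → ℝ → ℂ)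
    (hψ : ∀ x y : ℝ, ψ x y =
      Complex.exp (Real.pi * Complex.I * (N : ℂ) * τ * (y : ℂ) ^ 2) *
        jtheta ((l : ℝ) / (N : ℝ)) ((N : ℂ) * ((x : ℂ) + τ * (y : ℂ))) ((N : ℂ) * τ)) :
    (∫ y in (0:ℝ)..1, ∫ x in (0:ℝ)..1, ‖ψ x y‖ ^ 2) =
      (2 * (N : ℝ) * τ.im) ^ (-(1/2 : ℝ)) := by
  have hN0 : (0 : ℝ) < N := by exact_mod_cast hN
  have hNC : (N : ℂ) ≠ 0 := by exact_mod_cast hN0.ne'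
  have hσ : 0 < ((N : ℂ) * τ).im := by simpa using mul_pos hN0 hτ
  set β : ℝ := 2 * Real.pi * N * τ.im with hβ
  have hβ0 : 0 < β := by positivity
  let g : ℝ → ℝ := fun u ↦ Real.exp (-β * (u + l / N) ^ 2)
  have hg : MeasureTheory.Integrable g := (integrable_exp_neg_mul_sq hβ0).comp_add_right _
  have hfourier (x y : ℝ) : ψ x y =
      ∑' n : ℤ, Complex.exp (Real.pi * Complex.I * (N * τ) * (n + (y + l / N : ℂ)) ^ 2) *
        Complex.exp (2 * Real.pi * Complex.I * ((N * n + l : ℤ) : ℂ) * x) := by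
    rw [hψ, jtheta, ← tsum_mul_left]
    refine tsum_congr fun n ↦ ?_
    rw [← Complex.exp_add, ← Complex.exp_add]
    congr 1
    push_cast
    field_simp
    ring
  have hinj : Function.Injective fun n : ℤ ↦ (N * n + l : ℤ) := fun a b h ↦ by
    have : N ≠ 0 := by omega
    simpa [this] using h
  have hnorm (n : ℤ) (y : ℝ) :
      ‖Complex.exp (Real.pi * Complex.I * (N * τ) * (n + (y + l / N : ℂ)) ^ 2)‖ ^ 2 =
        g (y + n) := by
    have : Real.pi * Complex.I * (N * τ) * (n + (y + l / N : ℂ)) ^ 2 =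
        ((Real.pi * N * (y + n + l / N) ^ 2 : ℝ) : ℂ) * (Complex.I * τ) := by
      push_cast; ring
    rw [this, Complex.norm_exp, Complex.re_ofReal_mul, ← Real.exp_nat_mul]
    simp only [g, hβ]
    congr 1
    simp
    ring
  have hx (y : ℝ) : ∫ x in (0:ℝ)..1, ‖ψ x y‖ ^ 2 = ∑' n : ℤ, g (y + n) := by
    simp only [hfourier]
    rw [integral_norm_sq_tsum_exp _ (summable_norm_exp_shifted_gaussian hσ _) _ hinj]
    exact tsum_congr fun n ↦ hnorm n y
  simp only [hx]
  rw [integral_tsum_comp_add_int hg,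
    MeasureTheory.integral_add_right_eq_self (fun u ↦ Real.exp (-β * u ^ 2)),
    integral_gaussian, Real.rpow_neg (by positivity), ← Real.sqrt_eq_rpow, ← Real.sqrt_inv]
  congr 1
  rw [hβ]
  field_simp
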